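/- arXiv:1210.2957 — 2 statements merged into one kernel-verified Lean document; each statement's English description precedes it below -/
import Mathlib

section
/- For every sufficiently small δ > 0 (for instance, for every δ with 0 < δ < 1/16) there exists a C^∞ function f : ℝ → ℝ with the following properties: f(x) = 1 − x/δ⁴ for all x ∈ [0, δ⁴]; −δ² ≤ f(x) ≤ 0 and f′(x) ≤ δ for all x ∈ [δ⁴, δ]; f(x) = 0 for all x ≥ δ; and ∫₀^δ f(t) dt = 0. -/
open Set

/-- A smooth step from `1` to `0` on `[c - r, c + r]` with slope at least `-1 / r`, whose primitive
is that of the sharp step at `c`. -/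
theorem exists_smooth_step (c r : ℝ) (hr : 0 < r) :
    ∃ χ : ℝ → ℝ, ContDiff ℝ (⊤ : ℕ∞) χ ∧ (∀ x, 0 ≤ χ x ∧ χ x ≤ 1) ∧
      (∀ x, x ≤ c - r → χ x = 1) ∧ (∀ x, c + r ≤ x → χ x = 0) ∧
      (∀ x, -(1 / r) ≤ deriv χ x) ∧
      (∀ p q, p ≤ c - r → c + r ≤ q → (∫ t in p..q, χ t) = c - p) := by
  let b : ContDiffBump (0 : ℝ) := ⟨r / 2, r, by linarith, by linarith⟩
  set ψ : ℝ → ℝ := b.normed MeasureTheory.volume with hψ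
  have hψs : ContDiff ℝ (⊤ : ℕ∞) ψ := b.contDiff_normed
  have hψc : Continuous ψ := hψs.continuous
  have hii : ∀ u v, IntervalIntegrable ψ MeasureTheory.volume u v :=
    fun u v => hψc.intervalIntegrable u v
  have hψ0 : ∀ x, 0 ≤ ψ x := fun x => b.nonneg_normed x
  have hψle : ∀ x, ψ x ≤ 1 / r := by
    intro x
    refine (b.normed_le_div_measure_closedBall_rIn MeasureTheory.volume x).trans (le_of_eq ?_)
    have h : MeasureTheory.volume.real (Metric.closedBall (0 : ℝ) b.rIn) = r := by
      rw [Real.volume_real_closedBall (by simp only [b]; linarith)]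
      simp only [b]; ring
    rw [h]
  have hψout : ∀ x, r ≤ |x| → ψ x = 0 := by
    intro x hx
    have h : x ∉ Function.support ψ := by
      rw [hψ, b.support_normed_eq]
      simpa [b] using hx
    simpa using h
  have hψtot : ∀ u v, u ≤ -r → r ≤ v → (∫ t in u..v, ψ t) = 1 := by
    intro u v hu hv
    rw [← b.integral_normed (μ := MeasureTheory.volume),
      intervalIntegral.integral_eq_integral_of_support_subset]
    rw [b.support_normed_eq]
    intro x hx
    have hx' : |x| < r := by simpa [b] using hx
    rw [abs_lt] at hx'
    exact ⟨by linarith, by linarith⟩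
  have hψeven : ∀ x, ψ (-x) = ψ x := fun x => b.normed_neg x
  let Φ : ℝ → ℝ := fun x => ∫ t in x..r, ψ t
  have hΦd : ∀ x, HasDerivAt Φ (-ψ x) x := fun x =>
    intervalIntegral.integral_hasDerivAt_left (hii x r)
      (hψc.stronglyMeasurableAtFilter _ _) hψc.continuousAt
  have hΦs : ContDiff ℝ (⊤ : ℕ∞) Φ := by
    rw [contDiff_infty_iff_deriv]
    refine ⟨fun x => (hΦd x).differentiableAt, ?_⟩
    rw [show deriv Φ = fun x => -ψ x from funext fun x => (hΦd x).deriv]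
    exact hψs.neg
  have hΦanti : Antitone Φ :=
    antitone_of_deriv_nonpos (fun x => (hΦd x).differentiableAt)
      (fun x => by rw [(hΦd x).deriv]; linarith [hψ0 x])
  have hΦ1 : ∀ x, x ≤ -r → Φ x = 1 := fun x hx => hψtot x r hx le_rfl
  have hΦ0 : ∀ x, r ≤ x → Φ x = 0 := by
    intro x hx
    refine intervalIntegral.integral_zero_ae (Filter.Eventually.of_forall fun t ht => ?_)
    rw [uIoc_of_ge hx] at ht
    exact hψout t (ht.1.le.trans (le_abs_self t))
  have hΦsymm : ∀ x, Φ x + Φ (-x) = 1 := by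
    intro x
    have h1 : Φ (-x) = ∫ t in (-r)..x, ψ t := by
      have h := intervalIntegral.integral_comp_neg (a := -r) (b := x) ψ
      simp only [hψeven, neg_neg] at h
      exact h.symm
    rw [h1, add_comm]
    exact (intervalIntegral.integral_add_adjacent_intervals (hii _ _) (hii _ _)).trans
      (hψtot _ _ le_rfl le_rfl)
  have hΦi : ∀ u v, IntervalIntegrable Φ MeasureTheory.volume u v :=
    fun u v => hΦs.continuous.intervalIntegrable u v
  have hΦmid : (∫ t in (-r)..r, Φ t) = r := by
    have h1 := intervalIntegral.integral_comp_neg (a := -r) (b := r) Φ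
    rw [neg_neg] at h1
    have h2 : (∫ t in (-r)..r, (Φ t + Φ (-t))) = 2 * r := by
      simp only [hΦsymm, intervalIntegral.integral_const, smul_eq_mul]
      ring
    have h3 : Continuous fun t => Φ (-t) := hΦs.continuous.comp continuous_neg
    rw [intervalIntegral.integral_add (hΦi _ _) (h3.intervalIntegrable _ _), h1] at h2
    linarith
  refine ⟨fun x => Φ (x - c), hΦs.comp (contDiff_id.sub contDiff_const), fun x => ⟨?_, ?_⟩,
    fun x hx => hΦ1 _ (by linarith), fun x hx => hΦ0 _ (by linarith), fun x => ?_, ?_⟩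
  · rw [← hΦ0 (max (x - c) r) (le_max_right _ _)]
    exact hΦanti (le_max_left _ _)
  · rw [← hΦ1 (min (x - c) (-r)) (min_le_right _ _)]
    exact hΦanti (min_le_left _ _)
  · rw [deriv_comp_sub_const, (hΦd _).deriv]
    linarith [hψle (x - c)]
  · intro p q hp hq
    rw [intervalIntegral.integral_comp_sub_right Φ c,
      ← intervalIntegral.integral_add_adjacent_intervals (hΦi _ (-r)) (hΦi _ _),
      ← intervalIntegral.integral_add_adjacent_intervals (hΦi (-r) r) (hΦi _ _), hΦmid]
    have h1 : (∫ t in (p - c)..(-r), Φ t) = ∫ t in (p - c)..(-r), (1 : ℝ) := by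
      refine intervalIntegral.integral_congr fun t ht => ?_
      rw [uIcc_of_le (by linarith)] at ht
      exact hΦ1 t ht.2
    have h2 : (∫ t in r..(q - c), Φ t) = ∫ t in r..(q - c), (0 : ℝ) := by
      refine intervalIntegral.integral_congr fun t ht => ?_
      rw [uIcc_of_le (by linarith)] at ht
      exact hΦ0 t ht.1
    rw [h1, h2]
    simp only [intervalIntegral.integral_const, smul_eq_mul]
    ring

/-- A smooth nonnegative function equal to `1 - x / a + ε` for `x ≤ a`, nonincreasing, and vanishing
past `a + 2 * a * ε`. -/
theorem exists_smooth_hinge (a ε : ℝ) (ha : 0 < a) (hε : 0 < ε) :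
    ∃ A : ℝ → ℝ, ContDiff ℝ (⊤ : ℕ∞) A ∧ Antitone A ∧
      (∀ x, x ≤ a → A x = 1 - x / a + ε) ∧ (∀ x, a + 2 * a * ε ≤ x → A x = 0) := by
  have hr : 0 < a * ε := mul_pos ha hε
  obtain ⟨χ, hs, h01, -, h0, -, hint⟩ := exists_smooth_step (a + a * ε) (a * ε) hr
  have hii : ∀ u v, IntervalIntegrable χ MeasureTheory.volume u v :=
    fun u v => hs.continuous.intervalIntegrable u v
  let A : ℝ → ℝ := fun x => (1 / a) * ∫ t in x..(a + 2 * a * ε), χ t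
  have hAd : ∀ x, HasDerivAt A ((1 / a) * (-χ x)) x := fun x =>
    (intervalIntegral.integral_hasDerivAt_left (hii x _)
      (hs.continuous.stronglyMeasurableAtFilter _ _) hs.continuous.continuousAt).const_mul _
  refine ⟨A, ?_, ?_, fun x hx => ?_, fun x hx => ?_⟩
  · rw [contDiff_infty_iff_deriv]
    refine ⟨fun x => (hAd x).differentiableAt, ?_⟩
    rw [show deriv A = fun x => (1 / a) * (-χ x) from funext fun x => (hAd x).deriv]
    exact contDiff_const.mul hs.neg
  · refine antitone_of_deriv_nonpos (fun x => (hAd x).differentiableAt) fun x => ?_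
    rw [(hAd x).deriv, mul_neg, neg_nonpos]
    exact mul_nonneg (by positivity) (h01 x).1
  · simp only [A]
    rw [hint x _ (by linarith) (by linarith)]
    field_simp
    ring
  · have h : (∫ t in x..(a + 2 * a * ε), χ t) = 0 := by
      refine intervalIntegral.integral_zero_ae (Filter.Eventually.of_forall fun t ht => ?_)
      rw [uIoc_of_ge hx] at ht
      exact h0 t (by linarith [ht.1])
    simp only [A, h, mul_zero]

theorem exists_cutoff_function (δ : ℝ) (hδ0 : 0 < δ) (hδ : δ < 1 / 16) :
    ∃ f : ℝ → ℝ, ContDiff ℝ (⊤ : ℕ∞) f ∧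
      (∀ x ∈ Icc (0 : ℝ) (δ ^ 4), f x = 1 - x / δ ^ 4) ∧
      (∀ x ∈ Icc (δ ^ 4) δ, -δ ^ 2 ≤ f x ∧ f x ≤ 0 ∧ deriv f x ≤ δ) ∧
      (∀ x, δ ≤ x → f x = 0) ∧
      (∫ t in (0 : ℝ)..δ, f t) = 0 := by
  have h2 : δ ^ 2 ≤ δ / 16 := by nlinarith
  have h3 : δ ^ 3 ≤ δ ^ 2 / 16 := by nlinarith [sq_nonneg δ]
  have h4 : δ ^ 4 ≤ δ ^ 3 / 16 := by nlinarith [pow_pos hδ0 3]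
  have hε : 0 < δ ^ 3 := by positivity
  have ha : 0 < δ ^ 4 := by positivity
  set e : ℝ := δ ^ 4 + 2 * δ ^ 4 * δ ^ 3 with he
  have hae : δ ^ 4 ≤ e := by rw [he]; nlinarith
  have hed : e ≤ δ / 8 := by rw [he]; nlinarith
  obtain ⟨A, hAs, hAanti, hAl, hAr⟩ := exists_smooth_hinge (δ ^ 4) (δ ^ 3) ha hε
  rw [← he] at hAr
  have hAi : ∀ u v, IntervalIntegrable A MeasureTheory.volume u v :=
    fun u v => hAs.continuous.intervalIntegrable u v
  have hA0 : ∀ x, 0 ≤ A x := by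
    intro x
    rw [← hAr (max x e) (le_max_right _ _)]
    exact hAanti (le_max_left _ _)
  have hAa : A (δ ^ 4) = δ ^ 3 := by
    rw [hAl _ le_rfl, div_self ha.ne']
    ring
  have hAle : ∀ x, δ ^ 4 ≤ x → A x ≤ δ ^ 3 := fun x hx => hAa ▸ hAanti hx
  have hJ1 : (∫ t in (0 : ℝ)..(δ ^ 4), A t) = δ ^ 4 / 2 + δ ^ 4 * δ ^ 3 := by
    have h : (∫ t in (0 : ℝ)..(δ ^ 4), A t)
        = ∫ t in (0 : ℝ)..(δ ^ 4), ((1 + δ ^ 3) - t / δ ^ 4) := by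
      refine intervalIntegral.integral_congr fun t ht => ?_
      rw [uIcc_of_le ha.le] at ht
      simp only [hAl t ht.2]
      ring
    rw [h, intervalIntegral.integral_sub (by simp) (by simp), intervalIntegral.integral_div,
      integral_id, intervalIntegral.integral_const, smul_eq_mul]
    field_simp
    ring
  have hJ2 : (∫ t in (δ ^ 4)..e, A t) ≤ (e - δ ^ 4) * δ ^ 3 := by
    have h := intervalIntegral.integral_mono_on hae (hAi _ _)
      (intervalIntegrable_const (c := δ ^ 3)) (fun t ht => hAle t ht.1)
    simpa using h
  have hJ2' : 0 ≤ ∫ t in (δ ^ 4)..e, A t :=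
    intervalIntegral.integral_nonneg hae fun t _ => hA0 t
  have hJ3 : (∫ t in e..δ, A t) = 0 := by
    refine intervalIntegral.integral_zero_ae (Filter.Eventually.of_forall fun t ht => ?_)
    rw [uIoc_of_le (by linarith)] at ht
    exact hAr t ht.1.le
  have hJ : (∫ t in (0 : ℝ)..δ, A t)
      = δ ^ 4 / 2 + δ ^ 4 * δ ^ 3 + ∫ t in (δ ^ 4)..e, A t := by
    rw [← intervalIntegral.integral_add_adjacent_intervals (hAi 0 e) (hAi e δ),
      ← intervalIntegral.integral_add_adjacent_intervals (hAi 0 (δ ^ 4)) (hAi (δ ^ 4) e),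
      hJ1, hJ3, add_zero]
  set c : ℝ := (∫ t in (0 : ℝ)..δ, A t) / δ ^ 3 with hc
  have hc1 : δ / 2 ≤ c := by
    rw [hc, le_div_iff₀ hε, hJ]
    nlinarith [mul_pos ha hε]
  have hc2 : c ≤ 3 * δ / 4 := by
    have h : c ≤ δ / 2 + e := by
      rw [hc, div_le_iff₀ hε, hJ]
      nlinarith
    linarith
  obtain ⟨B, hBs, hB01, hBl, hBr, hBd, hBint⟩ := exists_smooth_step c (δ / 4) (by linarith)
  refine ⟨fun x => A x - δ ^ 3 * B x, hAs.sub (contDiff_const.mul hBs), ?_, ?_, ?_, ?_⟩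
  · intro x hx
    simp only [hAl x hx.2, hBl x (by linarith [hx.2])]
    ring
  · intro x hx
    refine ⟨?_, ?_, ?_⟩
    · nlinarith [hA0 x, (hB01 x).2]
    · rcases le_total x e with h | h
      · simp only [hBl x (by linarith)]
        linarith [hAle x hx.1]
      · simp only [hAr x h]
        nlinarith [(hB01 x).1]
    · have hAdiff : DifferentiableAt ℝ A x := hAs.differentiable (by simp) x
      have hBdiff : DifferentiableAt ℝ B x := hBs.differentiable (by simp) x
      rw [deriv_fun_sub hAdiff (hBdiff.const_mul _), deriv_const_mul _ hBdiff]
      have h1 : deriv A x ≤ 0 := hAanti.deriv_nonpos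
      have h5 := mul_le_mul_of_nonneg_left (hBd x) hε.le
      have h6 : δ ^ 3 * -(1 / (δ / 4)) = -(4 * δ ^ 2) := by field_simp
      linarith
  · intro x hx
    simp only [hAr x (by linarith), hBr x (by linarith)]
    ring
  · have hBc : Continuous fun t => δ ^ 3 * B t := continuous_const.mul hBs.continuous
    rw [intervalIntegral.integral_sub (hAi _ _) (hBc.intervalIntegrable _ _),
      intervalIntegral.integral_const_mul, hBint 0 δ (by linarith) (by linarith), hc]
    field_simp
    ring
end

section
/- Let n ≥ 1, let L be a real symmetric n×n matrix with L_{in} = L_{ni} = 0 for all i (i.e. L eₙ = 0), let Q = eₙeₙᵀ, and let μ₁, …, μₙ > 0. Then for all i, k: Σ_{l=1}^n μ_l⁻¹ (L∧Q)_{ilkl} = ½( μₙ⁻¹ L_{ik} + Q_{ik} Σ_{l=1}^n μ_l⁻¹ L_{ll} ). Consequently, if L is in addition positive semidefinite, then Σ_{i,k,l=1}^n μ_l⁻¹ (L∧Q)_{ilkl} ξ_i ξ_k = ½ μₙ⁻¹ ⟨ξ, Lξ⟩ + ½ ξₙ² Σ_{l=1}^n μ_l⁻¹ L_{ll} ≥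 0 for every ξ ∈ ℝⁿ. -/
open Finset

/-- The Kulkarni–Nomizu product of two matrices, as a 4-tensor. -/
noncomputable def kulkarniNomizu {n : ℕ} (A B : Matrix (Fin n) (Fin n) ℝ) (i j k l : Fin n) : ℝ :=
  (1 / 2) * (A i k * B j l - A j k * B i l + B i k * A j l - B j k * A i l)

/-- The weighted Ricci contraction of `L ∧ eeᵀ`, when `e` is a basis vector in the kernel of `L`. -/
theorem sum_mul_kulkarniNomizu_basis {n : ℕ} (e : Fin n) (L Q : Matrix (Fin n) (Fin n) ℝ)
    (hL : ∀ i, L i e = 0 ∧ L e i = 0)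
    (hQ : ∀ i j, Q i j = (if i = e then (1 : ℝ) else 0) * (if j = e then (1 : ℝ) else 0))
    (w : Fin n → ℝ) (i k : Fin n) :
    ∑ l, w l * kulkarniNomizu L Q i l k l =
      (1 / 2) * (w e * L i k + Q i k * ∑ l, w l * L l l) := by
  have key : ∀ l, w l * kulkarniNomizu L Q i l k l =
      (1 / 2) * ((if l = e then w e * L i k else 0) + Q i k * (w l * L l l)) := by
    intro l
    unfold kulkarniNomizu
    by_cases hl : l = e
    · subst hl
      rw [hQ l l, (hL k).2, (hL i).1, if_pos rfl, if_pos rfl]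
      ring
    · rw [hQ l l, hQ i l, hQ l k, if_neg hl, if_neg hl]
      ring
  simp only [key, ← Finset.mul_sum, Finset.sum_add_distrib, Finset.sum_ite_eq',
    Finset.mem_univ, if_true]

theorem weighted_ricci_of_L_wedge_PN {n : ℕ} (hn : 1 ≤ n)
    (en : Fin n) (hen : en = (⟨n - 1, by omega⟩ : Fin n))
    (L Q : Matrix (Fin n) (Fin n) ℝ) (hL : L.IsSymm)
    (hLn : ∀ i, L i en = 0 ∧ L en i = 0)
    (hQ : ∀ i j, Q i j = (if i = en then (1 : ℝ) else 0) * (if j = en then (1 : ℝ) else 0))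
    (μ : Fin n → ℝ) (hμ : ∀ l, 0 < μ l) :
    (∀ i k, ∑ l, (μ l)⁻¹ * kulkarniNomizu L Q i l k l =
      (1 / 2) * ((μ en)⁻¹ * L i k + Q i k * ∑ l, (μ l)⁻¹ * L l l)) ∧
    (L.PosSemidef → ∀ ξ : Fin n → ℝ,
      (∑ i, ∑ k, ∑ l, (μ l)⁻¹ * kulkarniNomizu L Q i l k l * ξ i * ξ k =
        (1 / 2) * (μ en)⁻¹ * (∑ i, ∑ k, ξ i * L i k * ξ k) +
          (1 / 2) * (ξ en) ^ 2 * ∑ l, (μ l)⁻¹ * L l l) ∧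
      0 ≤ ∑ i, ∑ k, ∑ l, (μ l)⁻¹ * kulkarniNomizu L Q i l k l * ξ i * ξ k) := by
  have ricci := sum_mul_kulkarniNomizu_basis en L Q hLn hQ (fun l => (μ l)⁻¹)
  refine ⟨ricci, fun hpos ξ => ?_⟩
  have hQξ : ∑ i, ∑ k, Q i k * (ξ i * ξ k) = ξ en ^ 2 := by
    simp [hQ, sq]
  have hquad : ∑ i, ∑ k, ∑ l, (μ l)⁻¹ * kulkarniNomizu L Q i l k l * ξ i * ξ k =
      (1 / 2) * (μ en)⁻¹ * (∑ i, ∑ k, ξ i * L i k * ξ k) +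
        (1 / 2) * (ξ en) ^ 2 * ∑ l, (μ l)⁻¹ * L l l := by
    simp only [← Finset.sum_mul, ricci, ← hQξ]
    simp only [Finset.mul_sum _ _ ((1 / 2) * (μ en)⁻¹), Finset.mul_sum _ _ ((1 / 2 : ℝ)),
      Finset.sum_mul _ _ (∑ l, (μ l)⁻¹ * L l l), ← Finset.sum_add_distrib]
    refine Finset.sum_congr rfl fun i _ => Finset.sum_congr rfl fun k _ => ?_
    ring
  refine ⟨hquad, ?_⟩
  have hξ : 0 ≤ ∑ i, ∑ k, ξ i * L i k * ξ k := by
    have h := hpos.dotProduct_mulVec_nonneg ξ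
    simpa [dotProduct, Matrix.mulVec, Finset.mul_sum, mul_assoc] using h
  have htrace : 0 ≤ ∑ l, (μ l)⁻¹ * L l l :=
    Finset.sum_nonneg fun l _ => mul_nonneg (inv_nonneg.2 (hμ l).le) hpos.diag_nonneg
  have hμen := hμ en
  rw [hquad]
  positivity
end
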